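/- arXiv:1912.05342 — 2 statements merged into one kernel-verified Lean document; each statement's English description precedes it below -/
import Mathlib

section
/- Let k₀ > 0 and let f : ℝ → ℝ be measurable with |f(s)| ≤ M for all s ∈ [−k₀,k₀]. Define, for k ∈ ℂ ∖ [−k₀,k₀] (the segment [−k₀,k₀] viewed inside ℝ ⊂ ℂ), δ(k) = exp( (1/(2πi)) ∫_{−k₀}^{k₀} f(s)/(s−k) ds ). Then: (i) δ is holomorphic on ℂ ∖ [−k₀,k₀]; (ii) δ is bounded there, with |δ(k)| ≤ e^{M/2} for all k ∈ ℂ ∖ [−k₀,k₀]; and (iii) δ(k) → 1 as |k| → ∞. -/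
open intervalIntegral

/-- The scalar function `δ(k) = exp((1/(2πi)) ∫_{−k₀}^{k₀} f(s)/(s−k) ds)` used in the
conjugation step of the nonlinear steepest descent method. -/
noncomputable def deltaFn (k₀ : ℝ) (f : ℝ → ℝ) (k : ℂ) : ℂ :=
  Complex.exp ((1 / (2 * Real.pi * Complex.I)) *
    ∫ s in (-k₀)..k₀, (f s : ℂ) / ((s : ℂ) - k))

open MeasureTheory in
theorem delta_aux_int (k₀ M : ℝ) (hk₀ : 0 < k₀) (f : ℝ → ℝ) (hf : Measurable f)
    (hM : ∀ s ∈ Set.Icc (-k₀) k₀, |f s| ≤ M) (k : ℂ) (d : ℝ) (hd : 0 < d)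
    (hk : ∀ s ∈ Set.Icc (-k₀) k₀, d ≤ ‖(s : ℂ) - k‖) :
    IntervalIntegrable (fun s : ℝ => (f s : ℂ) / ((s : ℂ) - k)) volume (-k₀) k₀ := by
  have hM0 : 0 ≤ M := (abs_nonneg _).trans (hM 0 ⟨by linarith, by linarith⟩)
  have hc : IntervalIntegrable (fun _ : ℝ => M / d) volume (-k₀) k₀ := intervalIntegrable_const
  refine hc.mono_fun (Measurable.aestronglyMeasurable (by measurability)) ?_
  refine (ae_restrict_iff' measurableSet_uIoc).2 (Filter.Eventually.of_forall fun s hs => ?_)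
  rw [Set.uIoc_of_le (by linarith)] at hs
  have hs' : s ∈ Set.Icc (-k₀) k₀ := ⟨hs.1.le, hs.2⟩
  change ‖(f s : ℂ) / ((s : ℂ) - k)‖ ≤ ‖M / d‖
  rw [Real.norm_of_nonneg (show 0 ≤ M / d by positivity), norm_div, Complex.norm_real,
    Real.norm_eq_abs]
  exact div_le_div₀ hM0 (hM s hs') hd (hk s hs')

theorem delta_aux_dist (k₀ : ℝ) (k : ℂ) (hk : k ∉ Complex.ofReal '' Set.Icc (-k₀) k₀) :
    ∃ d > 0, ∀ s ∈ Set.Icc (-k₀) k₀, d ≤ ‖(s : ℂ) - k‖ := by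
  have hcl : IsClosed (Complex.ofReal '' Set.Icc (-k₀) k₀) :=
    (isCompact_Icc.image Complex.continuous_ofReal).isClosed
  obtain ⟨d, hd, h⟩ := Metric.isOpen_iff.1 hcl.isOpen_compl k hk
  refine ⟨d, hd, fun s hs => ?_⟩
  by_contra! hlt
  exact h (show (s : ℂ) ∈ Metric.ball k d by rwa [Metric.mem_ball, dist_eq_norm]) ⟨s, hs, rfl⟩

open MeasureTheory in
theorem delta_aux_diff (k₀ M : ℝ) (hk₀ : 0 < k₀) (f : ℝ → ℝ) (hf : Measurable f)
    (hM : ∀ s ∈ Set.Icc (-k₀) k₀, |f s| ≤ M) (k : ℂ)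
    (hk : k ∉ Complex.ofReal '' Set.Icc (-k₀) k₀) :
    DifferentiableAt ℂ (fun k : ℂ => ∫ s in (-k₀)..k₀, (f s : ℂ) / ((s : ℂ) - k)) k := by
  have hM0 : 0 ≤ M := (abs_nonneg _).trans (hM 0 ⟨by linarith, by linarith⟩)
  obtain ⟨d, hd, h⟩ := delta_aux_dist k₀ k hk
  have key : ∀ x ∈ Metric.ball k (d / 2), ∀ s ∈ Set.Icc (-k₀) k₀, d / 2 ≤ ‖(s : ℂ) - x‖ := by
    intro x hx s hs
    rw [Metric.mem_ball, dist_eq_norm] at hx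
    have h1 := h s hs
    have h2 : ‖(s : ℂ) - k‖ ≤ ‖(s : ℂ) - x‖ + ‖x - k‖ := by
      simpa using norm_add_le ((s : ℂ) - x) (x - k)
    linarith
  have hI : ∀ s, s ∈ Set.uIoc (-k₀) k₀ → s ∈ Set.Icc (-k₀) k₀ := by
    intro s hs
    rw [Set.uIoc_of_le (by linarith)] at hs
    exact ⟨hs.1.le, hs.2⟩
  refine (intervalIntegral.hasDerivAt_integral_of_dominated_loc_of_deriv_le
    (F := fun k s => (f s : ℂ) / ((s : ℂ) - k)) (F' := fun k s => (f s : ℂ) / ((s : ℂ) - k) ^ 2)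
    (bound := fun _ => M / (d / 2) ^ 2)
    (Metric.ball_mem_nhds k (half_pos hd)) ?_ ?_ ?_ ?_ ?_ ?_).2.differentiableAt
  · exact Filter.Eventually.of_forall fun x => Measurable.aestronglyMeasurable (by measurability)
  · exact delta_aux_int k₀ M hk₀ f hf hM k d hd h
  · exact Measurable.aestronglyMeasurable (by measurability)
  · refine Filter.Eventually.of_forall fun s hs x hx => ?_
    rw [norm_div, Complex.norm_real, Real.norm_eq_abs, norm_pow]
    have := key x hx s (hI s hs)
    exact div_le_div₀ hM0 (hM s (hI s hs)) (by positivity) (by gcongr)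
  · exact intervalIntegrable_const
  · refine Filter.Eventually.of_forall fun s hs x hx => ?_
    have h1 := key x hx s (hI s hs)
    have hne : (s : ℂ) - x ≠ 0 := norm_pos_iff.1 (by linarith)
    have := (hasDerivAt_const x (f s : ℂ)).div ((hasDerivAt_id x).const_sub (s : ℂ)) hne
    refine this.congr_deriv ?_
    simp

theorem delta_aux_arctan (a c l r : ℝ) (hc : 0 < c) :
    ∫ s in l..r, c / ((s - a) ^ 2 + c ^ 2) ≤ Real.pi := by
  have hd : ∀ s ∈ Set.uIcc l r, HasDerivAt (fun s => Real.arctan ((s - a) / c))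
      (c / ((s - a) ^ 2 + c ^ 2)) s := by
    intro s _
    refine (((hasDerivAt_id s).sub_const a).div_const c).arctan.congr_deriv ?_
    simp only [id]
    field_simp
    ring
  rw [intervalIntegral.integral_eq_sub_of_hasDerivAt hd]
  · have := Real.arctan_lt_pi_div_two ((r - a) / c)
    have := Real.neg_pi_div_two_lt_arctan ((l - a) / c)
    linarith
  · apply Continuous.intervalIntegrable
    refine continuous_const.div (by fun_prop) fun s => by positivity

open MeasureTheory in
theorem delta_aux_im (k₀ M : ℝ) (hk₀ : 0 < k₀) (f : ℝ → ℝ) (hf : Measurable f)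
    (hM : ∀ s ∈ Set.Icc (-k₀) k₀, |f s| ≤ M) (k : ℂ)
    (hk : k ∉ Complex.ofReal '' Set.Icc (-k₀) k₀) :
    |(∫ s in (-k₀)..k₀, (f s : ℂ) / ((s : ℂ) - k)).im| ≤ M * Real.pi := by
  have hM0 : 0 ≤ M := (abs_nonneg _).trans (hM 0 ⟨by linarith, by linarith⟩)
  obtain ⟨d, hd, h⟩ := delta_aux_dist k₀ k hk
  have hint := delta_aux_int k₀ M hk₀ f hf hM k d hd h
  have e1 : (∫ s in (-k₀)..k₀, (f s : ℂ) / ((s : ℂ) - k)).im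
      = ∫ s in (-k₀)..k₀, ((f s : ℂ) / ((s : ℂ) - k)).im :=
    (Complex.imCLM.intervalIntegral_comp_comm hint).symm
  have e2 : ∀ s : ℝ, ((f s : ℂ) / ((s : ℂ) - k)).im = f s * (k.im / ((s - k.re) ^ 2 + k.im ^ 2)) := by
    intro s
    rw [Complex.div_im, Complex.normSq_apply]
    simp
    ring
  rw [e1]
  simp_rw [e2]
  rcases eq_or_ne k.im 0 with h0 | h0
  · simp only [h0, zero_div, mul_zero, intervalIntegral.integral_zero, abs_zero]
    positivity
  have hc : 0 < |k.im| := abs_pos.2 h0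
  calc _ ≤ ∫ s in (-k₀)..k₀, M * (|k.im| / ((s - k.re) ^ 2 + |k.im| ^ 2)) := by
        rw [← Real.norm_eq_abs]
        refine intervalIntegral.norm_integral_le_of_norm_le (by linarith)
          (Filter.Eventually.of_forall fun s hs => ?_) ?_
        · rw [Real.norm_eq_abs, abs_mul, abs_div, sq_abs,
            abs_of_nonneg (show 0 ≤ (s - k.re) ^ 2 + k.im ^ 2 by positivity)]
          exact mul_le_mul_of_nonneg_right (hM s ⟨hs.1.le, hs.2⟩) (by positivity)
        · apply Continuous.intervalIntegrable
          exact continuous_const.mul (continuous_const.div (by fun_prop) fun s => by positivity)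
    _ ≤ M * Real.pi := by
        rw [intervalIntegral.integral_const_mul]
        exact mul_le_mul_of_nonneg_left (delta_aux_arctan _ _ _ _ hc) hM0

theorem delta_aux_lim (k₀ M : ℝ) (hk₀ : 0 < k₀) (f : ℝ → ℝ)
    (hM : ∀ s ∈ Set.Icc (-k₀) k₀, |f s| ≤ M) :
    Filter.Tendsto (fun k : ℂ => ∫ s in (-k₀)..k₀, (f s : ℂ) / ((s : ℂ) - k))
      (Filter.cocompact ℂ) (nhds 0) := by
  have hM0 : 0 ≤ M := (abs_nonneg _).trans (hM 0 ⟨by linarith, by linarith⟩)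
  have hn : Filter.Tendsto (fun k : ℂ => ‖k‖) (Filter.cocompact ℂ) Filter.atTop :=
    tendsto_norm_cocompact_atTop
  have hlim : Filter.Tendsto (fun k : ℂ => M / (‖k‖ - k₀) * |k₀ - -k₀|)
      (Filter.cocompact ℂ) (nhds 0) := by
    have := ((Filter.tendsto_atTop_add_const_right _ (-k₀) hn).const_div_atTop M).mul_const
      |k₀ - -k₀|
    simpa [sub_eq_add_neg] using this
  refine squeeze_zero_norm' ?_ hlim
  filter_upwards [hn.eventually_gt_atTop k₀] with k hk
  refine intervalIntegral.norm_integral_le_of_norm_le_const fun s hs => ?_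
  rw [Set.uIoc_of_le (by linarith)] at hs
  rw [norm_div, Complex.norm_real, Real.norm_eq_abs]
  refine div_le_div₀ hM0 (hM s ⟨hs.1.le, hs.2⟩) (by linarith) ?_
  have h1 : ‖k‖ - ‖(s : ℂ)‖ ≤ ‖k - s‖ := norm_sub_norm_le _ _
  rw [norm_sub_rev, Complex.norm_real, Real.norm_eq_abs] at h1
  have h2 : |s| ≤ k₀ := abs_le.2 ⟨hs.1.le, hs.2⟩
  linarith

/-- Properties of `δ`: it is holomorphic on `ℂ ∖ [−k₀,k₀]`, bounded there by `e^{M/2}`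
whenever `|f| ≤ M` on `[−k₀,k₀]`, and tends to `1` as `|k| → ∞`. -/
theorem deltaFn_properties (k₀ M : ℝ) (hk₀ : 0 < k₀) (f : ℝ → ℝ) (hf : Measurable f)
    (hM : ∀ s ∈ Set.Icc (-k₀) k₀, |f s| ≤ M) :
    DifferentiableOn ℂ (deltaFn k₀ f) (Complex.ofReal '' Set.Icc (-k₀) k₀)ᶜ ∧
    (∀ k ∉ Complex.ofReal '' Set.Icc (-k₀) k₀,
      ‖deltaFn k₀ f k‖ ≤ Real.exp (M / 2)) ∧
    Filter.Tendsto (deltaFn k₀ f) (Filter.cocompact ℂ) (nhds 1) := by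
  refine ⟨fun k hk => ?_, fun k hk => ?_, ?_⟩
  · exact ((delta_aux_diff k₀ M hk₀ f hf hM k hk).const_mul _).cexp.differentiableWithinAt
  · have him := delta_aux_im k₀ M hk₀ f hf hM k hk
    rw [deltaFn, Complex.norm_exp]
    refine Real.exp_le_exp.2 ?_
    generalize (∫ s in (-k₀)..k₀, (f s : ℂ) / ((s : ℂ) - k)) = z at him ⊢
    have hc : (1 / (2 * Real.pi * Complex.I) : ℂ) = ((1 / (2 * Real.pi) : ℝ) : ℂ) * (-Complex.I) := by
      have : (Real.pi : ℂ) ≠ 0 := by exact_mod_cast Real.pi_ne_zero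
      push_cast
      field_simp
      simp
    have hr : ((1 / (2 * Real.pi * Complex.I) : ℂ) * z).re = z.im / (2 * Real.pi) := by
      rw [hc, mul_assoc, Complex.re_ofReal_mul]
      simp
      ring
    rw [hr, div_le_iff₀ (by positivity)]
    have := (le_abs_self _).trans him
    linarith
  · have h := ((delta_aux_lim k₀ M hk₀ f hM).const_mul (1 / (2 * Real.pi * Complex.I) : ℂ)).cexp
    rw [mul_zero, Complex.exp_zero] at h
    exact h
end

section
/- There exists a constant C > 0 such that for every g ∈ L²(ℝ), ∫₀^∞ ∫_{√3 v}^∞ |g(u)| e^{−2 u⁴ v} du dv ≤ C ‖g‖_{L²(ℝ)}. -/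
open MeasureTheory

noncomputable def dbarK (v u : ℝ) : ENNReal :=
  Set.indicator {p : ℝ × ℝ | Real.sqrt 3 * p.1 < p.2}
    (fun p => ENNReal.ofReal (Real.exp (-2 * p.2 ^ 4 * p.1))) (v, u)

noncomputable def dbarH (u : ℝ) : ENNReal := ENNReal.ofReal (Real.sqrt (2 * (1 + u ^ 2)⁻¹))

lemma dbarK_meas : Measurable (Function.uncurry dbarK) := by
  have : Function.uncurry dbarK = Set.indicator {p : ℝ × ℝ | Real.sqrt 3 * p.1 < p.2}
    (fun p => ENNReal.ofReal (Real.exp (-2 * p.2 ^ 4 * p.1))) := by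
    ext ⟨v, u⟩; rfl
  rw [this]
  refine Measurable.indicator (by fun_prop) ?_
  exact measurableSet_lt (by fun_prop) (by fun_prop)

lemma dbarK_int (u : ℝ) : ∫⁻ v in Set.Ioi (0 : ℝ), dbarK v u ≤ dbarH u := by
  have h3 : (1 : ℝ) ≤ Real.sqrt 3 := by
    rw [Real.one_le_sqrt]; norm_num
  rcases le_total u 1 with hu | hu
  · rcases le_total u 0 with h0 | h0
    · have : ∫⁻ v in Set.Ioi (0 : ℝ), dbarK v u = ∫⁻ v in Set.Ioi (0 : ℝ), 0 := by
        refine setLIntegral_congr_fun measurableSet_Ioi ?_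
        intro v hv
        have hv : 0 < v := hv
        refine Set.indicator_of_notMem ?_ _
        simp only [Set.mem_setOf_eq, not_lt]
        nlinarith
      rw [this]; simp
    · calc ∫⁻ v in Set.Ioi (0 : ℝ), dbarK v u
          ≤ ∫⁻ v in Set.Ioi (0 : ℝ), (Set.Ioc (0 : ℝ) 1).indicator 1 v := by
            refine setLIntegral_mono' measurableSet_Ioi ?_
            intro v hv
            have hv : 0 < v := hv
            unfold dbarK
            by_cases h : Real.sqrt 3 * v < u
            · rw [Set.indicator_of_mem (by exact h), Set.indicator_of_mem (by
                constructor
                · exact hv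
                · nlinarith)]
              simp only [Pi.one_apply, ENNReal.ofReal_le_one, Real.exp_le_one_iff]
              have : 0 ≤ u ^ 4 * v := by positivity
              linarith
            · rw [Set.indicator_of_notMem (by exact h)]; simp
        _ ≤ ∫⁻ v, (Set.Ioc (0 : ℝ) 1).indicator 1 v := setLIntegral_le_lintegral _ _
        _ = 1 := by rw [lintegral_indicator_one measurableSet_Ioc]; simp
        _ ≤ dbarH u := by
          unfold dbarH
          rw [ENNReal.one_le_ofReal, Real.one_le_sqrt, ← div_eq_mul_inv,
            le_div_iff₀ (by positivity)]
          nlinarith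
  · have hc : 0 < 2 * u ^ 4 := by positivity
    calc ∫⁻ v in Set.Ioi (0 : ℝ), dbarK v u
          ≤ ∫⁻ v in Set.Ioi (0 : ℝ), ENNReal.ofReal (Real.exp (-(2 * u ^ 4) * v)) := by
            refine lintegral_mono ?_
            intro v
            refine (Set.indicator_le_self _ _ _).trans ?_
            simp
      _ = ENNReal.ofReal (∫ v in Set.Ioi (0 : ℝ), Real.exp (-(2 * u ^ 4) * v)) := by
            rw [ofReal_integral_eq_lintegral_ofReal]
            · exact integrableOn_exp_mul_Ioi (by linarith) 0
            · exact Filter.Eventually.of_forall fun _ => (Real.exp_pos _).le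
      _ ≤ dbarH u := by
            rw [integral_exp_mul_Ioi (by linarith) 0]
            refine ENNReal.ofReal_le_ofReal (Real.le_sqrt_of_sq_le ?_)
            have e : (-Real.exp (-(2 * u ^ 4) * 0) / -(2 * u ^ 4)) ^ 2 = (4 * u ^ 8)⁻¹ := by
              simp; field_simp; norm_num
            have h2 : (1:ℝ) ≤ u ^ 2 := one_le_pow₀ hu
            have h8 : u ^ 2 ≤ u ^ 8 := pow_le_pow_right₀ hu (by norm_num)
            rw [e, ← div_eq_mul_inv, inv_eq_one_div, div_le_div_iff₀ (by positivity) (by positivity)]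
            nlinarith

lemma dbarH_fin : ∫⁻ u, dbarH u ^ (2 : ℝ) ≠ ⊤ := by
  have h : ∀ u, dbarH u ^ (2 : ℝ) = ENNReal.ofReal (2 * (1 + u ^ 2)⁻¹) := by
    intro u
    unfold dbarH
    rw [ENNReal.ofReal_rpow_of_nonneg (Real.sqrt_nonneg _) (by norm_num)]
    congr 1
    rw [Real.rpow_two, Real.sq_sqrt (by positivity)]
  simp_rw [h]
  exact (integrable_inv_one_add_sq.const_mul 2).lintegral_lt_top.ne

/-- There is a constant `C > 0` such that for every `g ∈ L²(ℝ)`,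
`∫₀^∞ ∫_{√3 v}^∞ |g(u)| e^{−2u⁴v} du dv ≤ C ‖g‖_{L²(ℝ)}`. -/
theorem dbar_L2_double_integral_bound :
    ∃ C : ℝ, 0 < C ∧ ∀ g : ℝ → ℝ, MemLp g 2 volume →
      (∫⁻ v in Set.Ioi (0 : ℝ), ∫⁻ u in Set.Ioi (Real.sqrt 3 * v),
          ENNReal.ofReal (|g u| * Real.exp (-2 * u ^ 4 * v)))
        ≤ ENNReal.ofReal C * eLpNorm g 2 volume := by
  set A := (∫⁻ u, dbarH u ^ (2 : ℝ)) ^ (1 / (2 : ℝ)) with hA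
  have hAfin : A ≠ ⊤ := ENNReal.rpow_ne_top_of_nonneg (by norm_num) dbarH_fin
  refine ⟨A.toReal + 1, by positivity, fun g hg => ?_⟩
  have hgm : AEMeasurable (fun u => ‖g u‖ₑ) volume := hg.1.enorm
  have hHm : Measurable dbarH := by unfold dbarH; fun_prop
  calc _ = ∫⁻ v in Set.Ioi (0 : ℝ), ∫⁻ u, ‖g u‖ₑ * dbarK v u := by
        refine lintegral_congr fun v => ?_
        rw [← lintegral_indicator measurableSet_Ioi]
        refine lintegral_congr fun u => ?_
        unfold dbarK
        by_cases h : Real.sqrt 3 * v < u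
        · rw [Set.indicator_of_mem (by exact h), Set.indicator_of_mem (by exact h),
            ENNReal.ofReal_mul (abs_nonneg _), Real.enorm_eq_ofReal_abs]
        · rw [Set.indicator_of_notMem (by exact h), Set.indicator_of_notMem (by exact h), mul_zero]
    _ = ∫⁻ u, ∫⁻ v in Set.Ioi (0 : ℝ), ‖g u‖ₑ * dbarK v u := by
        refine lintegral_lintegral_swap ?_
        exact (hgm.comp_snd).mul dbarK_meas.aemeasurable
    _ ≤ ∫⁻ u, ‖g u‖ₑ * dbarH u := by
        refine lintegral_mono fun u => ?_
        dsimp only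
        rw [lintegral_const_mul' _ _ (by simp)]
        gcongr
        exact dbarK_int u
    _ ≤ (∫⁻ u, ‖g u‖ₑ ^ (2 : ℝ)) ^ (1 / (2 : ℝ)) * A :=
        ENNReal.lintegral_mul_le_Lp_mul_Lq volume Real.HolderConjugate.two_two hgm hHm.aemeasurable
    _ = A * eLpNorm g 2 volume := by
        rw [eLpNorm_eq_lintegral_rpow_enorm_toReal (by norm_num) (by norm_num), mul_comm]
        simp
    _ ≤ _ := by
        gcongr
        rw [← ENNReal.ofReal_toReal hAfin]
        apply ENNReal.ofReal_le_ofReal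
        simp
end
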